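/- arXiv:2604.01717 — 6 statements merged into one kernel-verified Lean document; each statement's English description precedes it below -/
import Mathlib

section
/- Let G be a graph on n vertices with independence number α, and let λ > 0. Write n = mα + s with 0 ≤ s < α, and let k = α − s (so that the balanced disjoint union of cliques Z(n,α) has k components of order m = ⌊n/α⌋ and α − k components of order m+1 = ⌈n/α⌉). Then the occupancy fraction of G satisfies E_G(λ) ≤ E_{Z(n,α)}(λ) = (1/n)·( k·(⌊n/α⌋λ)/(1+⌊n/α⌋λ) + (α−k)·(⌈n/α⌉λ)/(1+⌈n/α⌉λ) ). Equivalently, (Σ_{I indep in G} |I|·λ^{|I|}) / (Σ_{I indep in G} λ^{|I|}) ≤ k·(⌊n/α⌋λ)/(1+⌊n/α⌋λ) + (α−k)·(⌈n/α⌉λ)/(1+⌈n/α⌉λ). -/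
open Finset

/- The finset of all independent sets (as finsets of vertices) of a graph `G`. -/
open Classical in
noncomputable def indepFinsets {V : Type*} [Fintype V] (G : SimpleGraph V) :
    Finset (Finset V) :=
  Finset.univ.filter fun s => ∀ u ∈ s, ∀ v ∈ s, ¬ G.Adj u v

lemma mem_indepFinsets {V : Type*} [Fintype V] {G : SimpleGraph V} {I : Finset V} :
    I ∈ indepFinsets G ↔ ∀ u ∈ I, ∀ v ∈ I, ¬ G.Adj u v := by
  simp [indepFinsets]

/-- The weighted independent set sum `∑ I, c I * ∏ v ∈ I, w v * lam`. -/
noncomputable def weightedIndepSum {V : Type*} [Fintype V] (G : SimpleGraph V)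
    (c : Finset V → ℝ) (lam : ℝ) (w : V → ℕ) : ℝ :=
  ∑ I ∈ indepFinsets G, c I * ∏ v ∈ I, ((w v : ℝ) * lam)

/-- Moving all the weight of two adjacent vertices to one of them: the weighted sum is
a convex combination of the two outcomes. -/
lemma weightedIndepSum_transfer {V : Type*} [Fintype V] [DecidableEq V] (G : SimpleGraph V)
    (c : Finset V → ℝ) (lam : ℝ) (w : V → ℕ) {u v : V} (huv : G.Adj u v) :
    ((w u : ℝ) + w v) * weightedIndepSum G c lam w =
      w u * weightedIndepSum G c lam
          (Function.update (Function.update w u (w u + w v)) v 0) +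
        w v * weightedIndepSum G c lam
          (Function.update (Function.update w v (w u + w v)) u 0) := by
  have hne := huv.ne
  unfold weightedIndepSum
  rw [mul_sum, mul_sum, mul_sum, ← sum_add_distrib]
  refine sum_congr rfl fun I hI => ?_
  have hout : ∀ (J : Finset V) (x y : V) (a b : ℕ), x ∉ J → y ∉ J →
      ∏ z ∈ J, ((Function.update (Function.update w x a) y b z : ℝ) * lam) =
        ∏ z ∈ J, ((w z : ℝ) * lam) := by
    intro J x y a b hx hy
    refine prod_congr rfl fun z hz => ?_
    rw [Function.update_of_ne (ne_of_mem_of_not_mem hz hy),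
      Function.update_of_ne (ne_of_mem_of_not_mem hz hx)]
  by_cases hu : u ∈ I
  · have hv : v ∉ I := fun hv => mem_indepFinsets.1 hI u hu v hv huv
    have hv' : v ∉ I.erase u := fun h => hv (mem_of_mem_erase h)
    have hu' : u ∉ I.erase u := notMem_erase u I
    simp only [← mul_prod_erase I _ hu, hout _ _ _ _ _ hu' hv', hout _ _ _ _ _ hv' hu']
    simp [hne]
    ring
  · by_cases hv : v ∈ I
    · have hv' : v ∉ I.erase v := notMem_erase v I
      have hu' : u ∉ I.erase v := fun h => hu (mem_of_mem_erase h)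
      simp only [← mul_prod_erase I _ hv, hout _ _ _ _ _ hu' hv', hout _ _ _ _ _ hv' hu']
      simp [hne.symm]
      ring
    · rw [hout _ _ _ _ _ hu hv, hout _ _ _ _ _ hv hu]
      ring

lemma sum_update_transfer {V : Type*} [Fintype V] [DecidableEq V] (w : V → ℕ) {u v : V}
    (hne : u ≠ v) :
    ∑ x, Function.update (Function.update w u (w u + w v)) v 0 x = ∑ x, w x := by
  have hu : u ∈ (univ : Finset V).erase v := by simp [hne]
  rw [← add_sum_erase univ _ (mem_univ v), ← add_sum_erase univ w (mem_univ v),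
    ← add_sum_erase _ _ hu, ← add_sum_erase _ w hu]
  have hrest : ∑ x ∈ (univ.erase v).erase u,
      Function.update (Function.update w u (w u + w v)) v 0 x =
        ∑ x ∈ (univ.erase v).erase u, w x := by
    refine sum_congr rfl fun x hx => ?_
    simp only [mem_erase, mem_univ, and_true] at hx
    rw [Function.update_of_ne hx.2, Function.update_of_ne hx.1]
  rw [hrest]
  simp [hne]
  omega

lemma card_support_update_transfer_lt {V : Type*} [Fintype V] [DecidableEq V] (w : V → ℕ)
    {u v : V} (hu : w u ≠ 0) (hv : w v ≠ 0) (a : ℕ) :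
    #{x | Function.update (Function.update w u a) v 0 x ≠ 0} < #{x | w x ≠ 0} := by
  refine card_lt_card (Finset.ssubset_iff_subset_ne.2 ⟨fun x hx => ?_, fun h => ?_⟩)
  · simp only [mem_filter, mem_univ, true_and, Function.update_apply] at hx ⊢
    split_ifs at hx with h1 h2
    · exact absurd rfl hx
    · exact h2 ▸ hu
    · exact hx
  · have : v ∈ ({x | w x ≠ 0} : Finset V) := by simpa using hv
    rw [← h] at this
    simp at this

/-- Symmetrization: integer weights can be concentrated on an independent set without
changing the total weight or decreasing the weighted sum. -/
lemma exists_indep_support_weightedIndepSum_le {V : Type*} [Fintype V] [DecidableEq V]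
    (G : SimpleGraph V) (c : Finset V → ℝ) (lam : ℝ) (w : V → ℕ) :
    ∃ w' : V → ℕ, ({x | w' x ≠ 0} : Finset V) ∈ indepFinsets G ∧ ∑ x, w' x = ∑ x, w x ∧
      weightedIndepSum G c lam w ≤ weightedIndepSum G c lam w' := by
  induction hN : #{x | w x ≠ 0} using Nat.strong_induction_on generalizing w with
  | _ N ih =>
  by_cases hind : ({x | w x ≠ 0} : Finset V) ∈ indepFinsets G
  · exact ⟨w, hind, rfl, le_rfl⟩
  simp only [mem_indepFinsets, mem_filter, mem_univ, true_and] at hind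
  push Not at hind
  obtain ⟨u, hu, v, hv, huv⟩ := hind
  have key := weightedIndepSum_transfer G c lam w huv
  have hu0 : (0 : ℝ) < w u := by exact_mod_cast Nat.pos_of_ne_zero hu
  have hv0 : (0 : ℝ) < w v := by exact_mod_cast Nat.pos_of_ne_zero hv
  by_cases hle : weightedIndepSum G c lam w ≤ weightedIndepSum G c lam
      (Function.update (Function.update w u (w u + w v)) v 0)
  · obtain ⟨w', h1, h2, h3⟩ := ih _
      (hN ▸ card_support_update_transfer_lt w hu hv (w u + w v)) _ rfl
    exact ⟨w', h1, h2.trans (sum_update_transfer w huv.ne), hle.trans h3⟩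
  · obtain ⟨w', h1, h2, h3⟩ := ih _
      (hN ▸ card_support_update_transfer_lt w hv hu (w u + w v)) _ rfl
    refine ⟨w', h1, h2.trans ?_, le_trans ?_ h3⟩
    · rw [add_comm (w u)]
      exact sum_update_transfer w huv.ne.symm
    · push Not at hle
      have := mul_lt_mul_of_pos_left hle hu0
      refine le_of_mul_le_mul_left ?_ hv0
      linarith

lemma sum_powerset_card_sub_mul_prod {V : Type*} [DecidableEq V] (x : V → ℝ)
    (hx : ∀ v, 0 ≤ x v) (T : Finset V) (C : ℝ) :
    ∑ I ∈ T.powerset, ((#I : ℝ) - C) * ∏ v ∈ I, x v =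
      (∏ v ∈ T, (1 + x v)) * (∑ v ∈ T, x v / (1 + x v) - C) := by
  induction T using Finset.induction_on generalizing C with
  | empty => simp
  | insert a T ha ih =>
    have hpos : 1 + x a ≠ 0 := by linarith [hx a]
    have hins : ∑ I ∈ T.powerset, ((#(insert a I) : ℝ) - C) * ∏ v ∈ insert a I, x v =
        x a * ∑ I ∈ T.powerset, ((#I : ℝ) - (C - 1)) * ∏ v ∈ I, x v := by
      rw [mul_sum]
      refine sum_congr rfl fun I hI => ?_
      have haI : a ∉ I := fun h => ha (mem_powerset.1 hI h)
      rw [card_insert_of_notMem haI, prod_insert haI]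
      push_cast
      ring
    rw [sum_powerset_insert ha, hins, ih, ih, prod_insert ha, sum_insert ha]
    field_simp
    ring

/-- The chord of `x ↦ x λ / (1 + x λ)` through consecutive integers `m` and `m + 1` lies above
the function at all integers. -/
lemma occupancy_le_chord (lam : ℝ) (hlam : 0 < lam) (m w : ℕ) :
    (w : ℝ) * lam / (1 + w * lam) ≤
      m * lam / (1 + m * lam) +
        (w - m) * (lam / ((1 + m * lam) * (1 + (m + 1) * lam))) := by
  have hsq : (0 : ℝ) ≤ ((w : ℝ) - m) * (w - m - 1) := by
    rcases le_or_gt w m with h | h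
    · have : (w : ℝ) ≤ m := by exact_mod_cast h
      nlinarith
    · have : (m : ℝ) + 1 ≤ w := by exact_mod_cast h
      nlinarith
  have h1 : (0 : ℝ) < 1 + w * lam := by positivity
  have h2 : (0 : ℝ) < 1 + m * lam := by positivity
  have h3 : (0 : ℝ) < 1 + (m + 1) * lam := by positivity
  rw [← sub_nonneg]
  have : (m : ℝ) * lam / (1 + m * lam) +
        (w - m) * (lam / ((1 + m * lam) * (1 + (m + 1) * lam))) - w * lam / (1 + w * lam) =
      ((w : ℝ) - m) * (w - m - 1) * lam ^ 2 /
        ((1 + w * lam) * (1 + m * lam) * (1 + (m + 1) * lam)) := by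
    field_simp
    ring
  rw [this]
  positivity

/-- Among at most `a` clique orders with total `m * a + s`, the balanced choice maximizes
the total occupancy. -/
lemma sum_occupancy_le_balanced {V : Type*} (T : Finset V) (w : V → ℕ) (a m s : ℕ)
    (hT : #T ≤ a) (hw : ∑ v ∈ T, w v = m * a + s) (lam : ℝ) (hlam : 0 < lam) :
    ∑ v ∈ T, (w v : ℝ) * lam / (1 + w v * lam) ≤
      ((a : ℝ) - s) * (m * lam / (1 + m * lam)) +
        s * ((m + 1) * lam / (1 + (m + 1) * lam)) := by
  set Δ : ℝ := lam / ((1 + m * lam) * (1 + (m + 1) * lam)) with hΔ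
  have h2 : (0 : ℝ) < 1 + m * lam := by positivity
  have h3 : (0 : ℝ) < 1 + (m + 1) * lam := by positivity
  have hsucc : (m + 1) * lam / (1 + (m + 1) * lam) = m * lam / (1 + m * lam) + Δ := by
    rw [hΔ]
    field_simp
    ring
  have hw' : ∑ v ∈ T, (w v : ℝ) = m * a + s := by exact_mod_cast hw
  have hT' : (#T : ℝ) ≤ a := by exact_mod_cast hT
  have hzero := occupancy_le_chord lam hlam m 0
  simp only [Nat.cast_zero, zero_mul, zero_div, zero_sub] at hzero
  calc ∑ v ∈ T, (w v : ℝ) * lam / (1 + w v * lam)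
      ≤ ∑ v ∈ T, (m * lam / (1 + m * lam) + ((w v : ℝ) - m) * Δ) :=
        sum_le_sum fun v _ => occupancy_le_chord lam hlam m (w v)
    _ = #T * (m * lam / (1 + m * lam)) + (m * a + s - #T * m) * Δ := by
        rw [sum_add_distrib, ← sum_mul, sum_sub_distrib, hw']
        simp
    _ ≤ _ := by
        rw [hsucc]
        have := mul_nonneg (sub_nonneg.2 hT') hzero
        rw [← hΔ] at this
        linarith

/-- Theorem 1 (upper bound on the occupancy fraction): if `G` has `n` vertices and
independence number `α`, writing `n = m·α + s` with `0 ≤ s < α` and `k = α − s`, then for any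
`λ > 0`,
`(Σ_I |I| λ^{|I|}) / (Σ_I λ^{|I|}) ≤ k·(mλ)/(1+mλ) + (α−k)·((m+1)λ)/(1+(m+1)λ)`,
where `m = ⌊n/α⌋` and `m+1 = ⌈n/α⌉`. -/
theorem occupancy_fraction_upper_bound {V : Type*} [Fintype V] (G : SimpleGraph V)
    (n α m s k : ℕ) (hn : Fintype.card V = n)
    (hα : (indepFinsets G).sup Finset.card = α)
    (hdiv : n = m * α + s) (hs : s < α) (hk : k = α - s)
    (lam : ℝ) (hlam : 0 < lam) :
    (∑ I ∈ indepFinsets G, (I.card : ℝ) * lam ^ I.card) /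
        (∑ I ∈ indepFinsets G, lam ^ I.card) ≤
      (k : ℝ) * ((m : ℝ) * lam / (1 + (m : ℝ) * lam)) +
        ((α - k : ℕ) : ℝ) * (((m : ℝ) + 1) * lam / (1 + ((m : ℝ) + 1) * lam)) := by
  classical
  set C : ℝ := (k : ℝ) * ((m : ℝ) * lam / (1 + (m : ℝ) * lam)) +
    ((α - k : ℕ) : ℝ) * (((m : ℝ) + 1) * lam / (1 + ((m : ℝ) + 1) * lam)) with hC
  have hpos : 0 < ∑ I ∈ indepFinsets G, lam ^ I.card :=
    sum_pos (fun I _ => pow_pos hlam _) ⟨∅, mem_indepFinsets.2 (by simp)⟩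
  rw [div_le_iff₀ hpos, ← sub_nonpos]
  have hsum : ∑ I ∈ indepFinsets G, (I.card : ℝ) * lam ^ I.card -
      C * ∑ I ∈ indepFinsets G, lam ^ I.card =
      weightedIndepSum G (fun I => (#I : ℝ) - C) lam fun _ => 1 := by
    rw [weightedIndepSum, mul_sum, ← sum_sub_distrib]
    refine sum_congr rfl fun I _ => ?_
    simp
    ring
  rw [hsum]
  obtain ⟨w, hind, hw, hle⟩ := exists_indep_support_weightedIndepSum_le G
    (fun I => (#I : ℝ) - C) lam fun _ => 1
  refine hle.trans ?_
  set T : Finset V := {x | w x ≠ 0} with hT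
  have hwT : ∑ v ∈ T, w v = m * α + s := by
    rw [hT, sum_filter_ne_zero, hw, ← hdiv, ← hn]
    simp
  have hsub : T.powerset ⊆ indepFinsets G := fun I hI => mem_indepFinsets.2 fun u hu v hv =>
    mem_indepFinsets.1 hind u (mem_powerset.1 hI hu) v (mem_powerset.1 hI hv)
  have hrestrict : weightedIndepSum G (fun I => (#I : ℝ) - C) lam w =
      ∑ I ∈ T.powerset, ((#I : ℝ) - C) * ∏ v ∈ I, ((w v : ℝ) * lam) := by
    refine (sum_subset hsub fun I _ hI => ?_).symm
    obtain ⟨v, hv, hvT⟩ := not_subset.1 (mt mem_powerset.2 hI)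
    have hv0 : w v = 0 := by simpa [hT] using hvT
    rw [prod_eq_zero hv (by simp [hv0]), mul_zero]
  rw [hrestrict, sum_powerset_card_sub_mul_prod _ (fun v => by positivity)]
  refine mul_nonpos_of_nonneg_of_nonpos (prod_nonneg fun v _ => by positivity) (sub_nonpos.2 ?_)
  have hTα : #T ≤ α := hα ▸ le_sup (f := card) hind
  have hbal := sum_occupancy_le_balanced T w α m s hTα hwT lam hlam
  have hk' : (k : ℝ) = α - s := by rw [hk, Nat.cast_sub hs.le]
  have hs' : α - k = s := by omega
  rwa [hC, hk', hs']
end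

section
/- Let G be a graph on n vertices (n > 2) with independence number α, and let 0 < λ < 2/(n−2). Then the occupancy fraction of G satisfies E_G(λ) ≥ E_{K_{n−α} ∨ αK_1}(λ) = (1/n)·( αλ(1+λ)^{α−1} + (n−α)λ ) / ( (1+λ)^α + (n−α)λ ). Equivalently, (Σ_{I indep in G} |I|·λ^{|I|}) / (Σ_{I indep in G} λ^{|I|}) ≥ ( αλ(1+λ)^{α−1} + (n−α)λ ) / ( (1+λ)^α + (n−α)λ ). -/
open Finset

/-- The sum of `x ^ |t|` over all subsets `t` of `s` is `(1 + x) ^ |s|`. -/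
theorem sum_powerset_pow_card {V : Type*} (s : Finset V) (x : ℝ) :
    ∑ t ∈ s.powerset, x ^ t.card = (1 + x) ^ s.card := by
  simpa [add_comm] using Finset.sum_pow_mul_eq_add_pow x 1 s

/-- The sum of `|t| x ^ |t|` over all subsets `t` of `s` is `|s| x (1 + x) ^ (|s| - 1)`. -/
theorem sum_powerset_card_mul_pow_card {V : Type*} (s : Finset V) (x : ℝ) :
    ∑ t ∈ s.powerset, (t.card : ℝ) * x ^ t.card =
      (s.card : ℝ) * x * (1 + x) ^ (s.card - 1) := by
  classical
  induction s using Finset.induction_on with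
  | empty => simp
  | insert a s ha ih =>
    have h : ∀ t ∈ s.powerset, ((insert a t).card : ℝ) * x ^ (insert a t).card =
        x * ((t.card : ℝ) * x ^ t.card) + x * x ^ t.card := by
      intro t ht
      rw [Finset.card_insert_of_notMem fun hat => ha (Finset.mem_powerset.1 ht hat)]
      push_cast
      ring
    rw [Finset.sum_powerset_insert ha, Finset.sum_congr rfl h, Finset.sum_add_distrib,
      ← Finset.mul_sum, ← Finset.mul_sum, ih, sum_powerset_pow_card,
      Finset.card_insert_of_notMem ha, Nat.add_sub_cancel]
    rcases Nat.eq_zero_or_pos s.card with h0 | h0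
    · simp [h0]
    · obtain ⟨m, hm⟩ := Nat.exists_eq_add_of_lt h0
      rw [hm, zero_add, Nat.add_sub_cancel]
      push_cast
      ring

/-- Independent sets other than the subsets of a fixed independent set `S` and the singletons
outside `S` have at least two elements, so a function of the cardinality that is nonnegative
from `2` on has its sum over the independent sets bounded below by the sum over the former. -/
theorem le_sum_indepFinsets {V : Type*} [Fintype V] (G : SimpleGraph V) {S : Finset V}
    (hS : S ∈ indepFinsets G) (f : ℕ → ℝ) (hf : ∀ k, 2 ≤ k → 0 ≤ f k) :
    ∑ t ∈ S.powerset, f t.card + ((Fintype.card V : ℝ) - S.card) * f 1 ≤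
      ∑ I ∈ indepFinsets G, f I.card := by
  classical
  have hdisj : Disjoint S.powerset (Sᶜ.map ⟨singleton, Finset.singleton_injective⟩) := by
    rw [Finset.disjoint_left]
    intro t ht ht'
    obtain ⟨v, hv, rfl⟩ := Finset.mem_map.1 ht'
    exact Finset.mem_compl.1 hv (Finset.mem_powerset.1 ht (Finset.mem_singleton_self v))
  have hsum : ∑ t ∈ S.powerset, f t.card + ((Fintype.card V : ℝ) - S.card) * f 1 =
      ∑ t ∈ S.powerset ∪ Sᶜ.map ⟨singleton, Finset.singleton_injective⟩, f t.card := by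
    rw [Finset.sum_union hdisj, Finset.sum_map]
    simp [Finset.card_compl, Nat.cast_sub (Finset.card_le_univ S)]
  rw [hsum]
  apply Finset.sum_le_sum_of_subset_of_nonneg
  · intro t ht
    simp only [indepFinsets, Finset.mem_filter, Finset.mem_univ, true_and] at hS ⊢
    rcases Finset.mem_union.1 ht with ht | ht
    · have hsub := Finset.mem_powerset.1 ht
      exact fun u hu v hv => hS u (hsub hu) v (hsub hv)
    · obtain ⟨v, -, rfl⟩ := Finset.mem_map.1 ht
      simp
  · intro t _ ht
    apply hf
    by_contra hlt
    apply ht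
    rw [Finset.mem_union, Finset.mem_powerset, Finset.mem_map]
    rcases Nat.lt_or_ge t.card 1 with h0 | h1
    · left
      simp [Finset.card_eq_zero.1 (Nat.lt_one_iff.1 h0)]
    · obtain ⟨v, rfl⟩ := Finset.card_eq_one.1 (by omega : t.card = 1)
      by_cases hv : v ∈ S
      · exact Or.inl (by simpa using hv)
      · exact Or.inr ⟨v, by simpa using hv, rfl⟩

/-- Theorem 2 (lower bound on the occupancy fraction): if `G` has `n > 2` vertices and
independence number `α`, then for `0 < λ < 2/(n−2)`,
`(Σ_I |I| λ^{|I|}) / (Σ_I λ^{|I|}) ≥ (αλ(1+λ)^{α−1} + (n−α)λ) / ((1+λ)^α + (n−α)λ)`,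
the right-hand side being `n` times the occupancy fraction of `K_{n−α} ∨ αK_1`. -/
theorem occupancy_fraction_lower_bound {V : Type*} [Fintype V] (G : SimpleGraph V)
    (n α : ℕ) (hn : Fintype.card V = n) (hn2 : 2 < n)
    (hα : (indepFinsets G).sup Finset.card = α)
    (lam : ℝ) (hlam : 0 < lam) (hlam2 : lam < 2 / ((n : ℝ) - 2)) :
    (∑ I ∈ indepFinsets G, (I.card : ℝ) * lam ^ I.card) /
        (∑ I ∈ indepFinsets G, lam ^ I.card) ≥
      ((α : ℝ) * lam * (1 + lam) ^ (α - 1) + ((n : ℝ) - (α : ℝ)) * lam) /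
        ((1 + lam) ^ α + ((n : ℝ) - (α : ℝ)) * lam) := by
  have hempty : ∅ ∈ indepFinsets G := by simp [indepFinsets]
  obtain ⟨S, hS, hSα⟩ := Finset.exists_mem_eq_sup (indepFinsets G) ⟨∅, hempty⟩ Finset.card
  rw [hα] at hSα
  have hαn : (α : ℝ) ≤ n := by
    rw [hSα, ← hn]
    exact_mod_cast Finset.card_le_univ S
  have hn2' : (0 : ℝ) < n - 2 := by
    have : (2 : ℝ) < n := by exact_mod_cast hn2
    linarith
  have hmul : lam * ((n : ℝ) - 2) < 2 := (lt_div_iff₀ hn2').1 hlam2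
  have hrest : 0 ≤ ((n : ℝ) - α) * lam := mul_nonneg (by linarith) hlam.le
  have hden : 0 < (1 + lam) ^ α + ((n : ℝ) - (α : ℝ)) * lam := by positivity
  have hZ : 0 < ∑ I ∈ indepFinsets G, lam ^ I.card :=
    Finset.sum_pos (fun _ _ => by positivity) ⟨∅, hempty⟩
  set e := ((α : ℝ) * lam * (1 + lam) ^ (α - 1) + ((n : ℝ) - (α : ℝ)) * lam) /
    ((1 + lam) ^ α + ((n : ℝ) - (α : ℝ)) * lam) with he
  have hnum : e * ((1 + lam) ^ α + ((n : ℝ) - (α : ℝ)) * lam) =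
      (α : ℝ) * lam * (1 + lam) ^ (α - 1) + ((n : ℝ) - (α : ℝ)) * lam :=
    div_mul_cancel₀ _ hden.ne'
  have he2 : e ≤ 2 := by
    rw [he, div_le_iff₀ hden]
    rcases Nat.eq_zero_or_pos α with h0 | h0
    · subst h0
      simp only [Nat.cast_zero, sub_zero] at hrest
      simp
      linarith
    · obtain ⟨m, rfl⟩ := Nat.exists_eq_add_of_lt h0
      have hcoef : 0 ≤ 2 * (1 + lam) - ((0 + m + 1 : ℕ) : ℝ) * lam := by
        nlinarith
      have hpow : 0 ≤ (1 + lam) ^ (0 + m) := by positivity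
      rw [Nat.add_sub_cancel, pow_succ (1 + lam) (0 + m)]
      nlinarith [mul_nonneg hpow hcoef]
  have key := le_sum_indepFinsets G hS (fun k => (k : ℝ) * lam ^ k - e * lam ^ k) (by
    intro k hk
    have hk' : (2 : ℝ) ≤ k := by exact_mod_cast hk
    rw [← sub_mul]
    exact mul_nonneg (by linarith) (by positivity))
  simp only [Finset.sum_sub_distrib, ← Finset.mul_sum, sum_powerset_card_mul_pow_card,
    sum_powerset_pow_card, ← hSα, hn, Nat.cast_one, one_mul, pow_one] at key
  rw [ge_iff_le, le_div_iff₀ hZ]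
  linarith
end

section
/- Let G be a graph on n vertices with independence number α, and let λ > 0. Write n = mα + s with 0 ≤ s < α, and let k = α − s. Then the independence polynomial satisfies P_G(λ) ≤ P_{Z(n,α)}(λ) = (1 + ⌊n/α⌋λ)^k · (1 + ⌈n/α⌉λ)^{α−k}. -/
open Finset

/- The independence polynomial `P_G(x) = Σ_{I independent} x^{|I|}`. -/
noncomputable def indepPoly {V : Type*} [Fintype V] (G : SimpleGraph V) (x : ℝ) : ℝ :=
  ∑ I ∈ indepFinsets G, x ^ I.card

/-- The value at `x` of the independence polynomial of the disjoint union of `a` cliques of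
nearly equal orders on `n` vertices. -/
noncomputable def balancedPoly (x : ℝ) (n a : ℕ) : ℝ :=
  (1 + ((n / a : ℕ) : ℝ) * x) ^ (a - n % a) * (1 + (((n / a : ℕ) : ℝ) + 1) * x) ^ (n % a)

theorem balancedPoly_mul_add (x : ℝ) {a m s : ℕ} (hs : s ≤ a) :
    balancedPoly x (m * a + s) a =
      (1 + (m : ℝ) * x) ^ (a - s) * (1 + ((m : ℝ) + 1) * x) ^ s := by
  rcases Nat.eq_zero_or_pos a with rfl | ha
  · obtain rfl : s = 0 := by omega
    simp [balancedPoly]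
  rcases hs.lt_or_eq with h | rfl
  · have h1 : (m * a + s) / a = m := by
      rw [mul_comm, Nat.mul_add_div ha, Nat.div_eq_of_lt h, add_zero]
    have h2 : (m * a + s) % a = s := by
      rw [mul_comm, Nat.mul_add_mod, Nat.mod_eq_of_lt h]
    rw [balancedPoly, h1, h2]
  · have h0 : m * s + s = (m + 1) * s := by ring
    rw [balancedPoly, h0, Nat.mul_div_cancel _ ha, Nat.mul_mod_left]
    simp

/-- Every positive `n` is `m * (b + 1) + (t + 1)` with `t ≤ b`. -/
theorem exists_eq_mul_add_succ {n : ℕ} (hn : 0 < n) (b : ℕ) :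
    ∃ m t, t ≤ b ∧ n = m * (b + 1) + (t + 1) := by
  refine ⟨(n - 1) / (b + 1), (n - 1) % (b + 1), ?_, ?_⟩
  · exact Nat.lt_succ_iff.mp (Nat.mod_lt _ b.succ_pos)
  · have := Nat.div_add_mod' (n - 1) (b + 1)
    omega

theorem balancedPoly_recurrence (x : ℝ) {b m t : ℕ} (ht : t ≤ b) :
    balancedPoly x (m * (b + 1) + (t + 1)) (b + 1) =
      balancedPoly x (m * (b + 1) + t) (b + 1) + x * balancedPoly x (m * b + t) b := by
  rw [balancedPoly_mul_add x (by omega), balancedPoly_mul_add x (by omega),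
    balancedPoly_mul_add x ht, show b + 1 - (t + 1) = b - t by omega,
    show b + 1 - t = (b - t) + 1 by omega]
  ring

theorem balancedPoly_nonneg {x : ℝ} (hx : 0 ≤ x) (n a : ℕ) : 0 ≤ balancedPoly x n a := by
  unfold balancedPoly
  positivity

theorem balancedPoly_mono {x : ℝ} (hx : 0 ≤ x) (a : ℕ) :
    Monotone fun n => balancedPoly x n a := by
  refine monotone_nat_of_le_succ fun n => ?_
  cases a with
  | zero =>
    simp only [balancedPoly, Nat.div_zero, Nat.mod_zero, Nat.zero_sub, pow_zero, one_mul,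
      Nat.cast_zero, zero_add]
    exact pow_le_pow_right₀ (by linarith) n.le_succ
  | succ b =>
    obtain ⟨m, t, ht, h⟩ := exists_eq_mul_add_succ n.succ_pos b
    obtain rfl : n = m * (b + 1) + t := by omega
    simp only [add_assoc]
    rw [balancedPoly_recurrence x ht]
    have := mul_nonneg hx (balancedPoly_nonneg hx (m * b + t) b)
    linarith

open Classical in
/-- The independent sets of `G` contained in `S`. -/
noncomputable def indepSubsets {V : Type*} (G : SimpleGraph V) (S : Finset V) :
    Finset (Finset V) :=
  S.powerset.filter fun I => ∀ u ∈ I, ∀ v ∈ I, ¬ G.Adj u v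

theorem mem_indepSubsets {V : Type*} {G : SimpleGraph V} {S I : Finset V} :
    I ∈ indepSubsets G S ↔ I ⊆ S ∧ ∀ u ∈ I, ∀ v ∈ I, ¬ G.Adj u v := by
  simp [indepSubsets]

theorem indepSubsets_univ {V : Type*} [Fintype V] (G : SimpleGraph V) :
    indepSubsets G univ = indepFinsets G := by
  ext I
  simp [mem_indepSubsets, indepFinsets]

open Classical in
theorem insert_mem_indepSubsets {V : Type*} {G : SimpleGraph V} {S I : Finset V} {v : V}
    (hv : v ∈ S) (hI : I ∈ indepSubsets G (S.filter fun u => ¬ (u = v ∨ G.Adj v u))) :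
    v ∉ I ∧ insert v I ∈ indepSubsets G S := by
  obtain ⟨hsub, hind⟩ := mem_indepSubsets.1 hI
  have hmem : ∀ u ∈ I, u ∈ S ∧ ¬ (u = v ∨ G.Adj v u) := fun u hu => mem_filter.1 (hsub hu)
  refine ⟨fun h => (hmem v h).2 (Or.inl rfl), mem_indepSubsets.2 ⟨?_, ?_⟩⟩
  · exact insert_subset hv fun u hu => (hmem u hu).1
  · intro u hu w hw
    rcases mem_insert.1 hu with rfl | huI <;> rcases mem_insert.1 hw with rfl | hwI
    · exact G.irrefl
    · exact fun h => (hmem w hwI).2 (Or.inr h)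
    · exact fun h => (hmem u huI).2 (Or.inr h.symm)
    · exact hind u huI w hwI

open Classical in
theorem sum_indepSubsets_eq {V : Type*} (G : SimpleGraph V) (x : ℝ) {S : Finset V} {v : V}
    (hv : v ∈ S) :
    ∑ I ∈ indepSubsets G S, x ^ #I = ∑ I ∈ indepSubsets G (S.erase v), x ^ #I +
      x * ∑ I ∈ indepSubsets G (S.filter fun u => ¬ (u = v ∨ G.Adj v u)), x ^ #I := by
  rw [← sum_filter_not_add_sum_filter (indepSubsets G S) (fun I => v ∈ I), mul_sum]
  congr 1
  · refine sum_congr ?_ fun _ _ => rfl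
    ext I
    simp only [mem_filter, mem_indepSubsets, subset_erase]
    tauto
  · symm
    refine sum_bij (fun I _ => insert v I) ?_ ?_ ?_ ?_
    · intro I hI
      exact mem_filter.2 ⟨(insert_mem_indepSubsets hv hI).2, mem_insert_self v I⟩
    · intro I hI J hJ h
      rw [← erase_insert (insert_mem_indepSubsets hv hI).1, h,
        erase_insert (insert_mem_indepSubsets hv hJ).1]
    · intro I hI
      obtain ⟨hI, hvI⟩ := mem_filter.1 hI
      obtain ⟨hsub, hind⟩ := mem_indepSubsets.1 hI
      refine ⟨I.erase v, mem_indepSubsets.2 ⟨fun u hu => ?_, fun u hu w hw => ?_⟩,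
        insert_erase hvI⟩
      · obtain ⟨hne, huI⟩ := mem_erase.1 hu
        exact mem_filter.2 ⟨hsub huI, not_or.2 ⟨hne, hind v hvI u huI⟩⟩
      · exact hind u (mem_of_mem_erase hu) w (mem_of_mem_erase hw)
    · intro I hI
      rw [card_insert_of_notMem (insert_mem_indepSubsets hv hI).1, pow_succ']

open Classical in
/-- If all independent subsets of `S` have at most `a` elements and `m * a < #S`, then some
vertex of `S` has a closed neighbourhood in `S` with more than `m` elements. -/
theorem exists_lt_card_closedNeighborhood {V : Type*} (G : SimpleGraph V) {S : Finset V}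
    {a m : ℕ} (hS : ∀ I ∈ indepSubsets G S, #I ≤ a) (hm : m * a < #S) :
    ∃ v ∈ S, m < #(S.filter fun u => u = v ∨ G.Adj v u) := by
  by_contra! h
  have hne : (indepSubsets G S).Nonempty := ⟨∅, mem_indepSubsets.2 (by simp)⟩
  obtain ⟨I, hI, hmax⟩ := exists_max_image (indepSubsets G S) card hne
  obtain ⟨hsub, hind⟩ := mem_indepSubsets.1 hI
  have hcover : S ⊆ I.biUnion fun v => S.filter fun u => u = v ∨ G.Adj v u := by
    intro u hu
    by_contra hcon
    simp only [mem_biUnion, mem_filter, not_exists, not_and, hu, true_and] at hcon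
    have hI' : I ∈ indepSubsets G (S.filter fun w => ¬ (w = u ∨ G.Adj u w)) := by
      refine mem_indepSubsets.2 ⟨fun w hw => mem_filter.2 ⟨hsub hw, ?_⟩, hind⟩
      rintro (h | h)
      · exact hcon w hw (Or.inl h.symm)
      · exact hcon w hw (Or.inr h.symm)
    obtain ⟨hnot, hins⟩ := insert_mem_indepSubsets hu hI'
    have := hmax _ hins
    rw [card_insert_of_notMem hnot] at this
    omega
  have h1 : #S ≤ #I * m :=
    (card_le_card hcover).trans (card_biUnion_le_card_mul _ _ _ fun v hv => h v (hsub hv))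
  have h2 : #I * m ≤ a * m := Nat.mul_le_mul_right m (hS I hI)
  rw [mul_comm a m] at h2
  omega

theorem sum_indepSubsets_le_balancedPoly {V : Type*} (G : SimpleGraph V) {x : ℝ} (hx : 0 ≤ x)
    (S : Finset V) (a : ℕ) (hS : ∀ I ∈ indepSubsets G S, #I ≤ a) :
    ∑ I ∈ indepSubsets G S, x ^ #I ≤ balancedPoly x #S a := by
  classical
  induction hN : #S using Nat.strong_induction_on generalizing S a with
  | _ N ih =>
  subst hN
  rcases S.eq_empty_or_nonempty with rfl | hne
  · have : indepSubsets G (∅ : Finset V) = {∅} := by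
      ext I
      simp +contextual [mem_indepSubsets]
    simp [this, balancedPoly]
  cases a with
  | zero =>
    obtain ⟨v, hv⟩ := hne
    have := hS {v} (mem_indepSubsets.2 (by simpa using hv))
    simp at this
  | succ b =>
    obtain ⟨m, t, ht, hcard⟩ := exists_eq_mul_add_succ hne.card_pos b
    obtain ⟨v, hv, hdeg⟩ := exists_lt_card_closedNeighborhood G (m := m) hS (by omega)
    set T := S.filter fun u => ¬ (u = v ∨ G.Adj v u)
    have hsplit : #(S.filter fun u => u = v ∨ G.Adj v u) + #T = #S :=
      card_filter_add_card_filter_not _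
    have herase : #(S.erase v) = m * (b + 1) + t := by
      rw [card_erase_of_mem hv]
      omega
    have hTle : #T ≤ m * b + t := by
      rw [mul_add, mul_one] at hcard
      omega
    have h1 := ih _ (by omega) (S.erase v) (b + 1) (fun I hI => hS I <| by
      rw [mem_indepSubsets] at hI ⊢
      exact ⟨hI.1.trans (erase_subset v S), hI.2⟩) herase
    have h2 := ih _ (by omega) T b (fun I hI => by
      obtain ⟨hnot, hins⟩ := insert_mem_indepSubsets hv hI
      have := hS _ hins
      rw [card_insert_of_notMem hnot] at this
      omega) rfl
    rw [sum_indepSubsets_eq G x hv, hcard, balancedPoly_recurrence x ht]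
    exact add_le_add h1
      (mul_le_mul_of_nonneg_left (h2.trans (balancedPoly_mono hx b hTle)) hx)

/-- Upper bound on the independence polynomial: if `G` has `n` vertices and independence
number `α`, writing `n = m·α + s` with `0 ≤ s < α` and `k = α − s`, then for any `λ > 0`,
`P_G(λ) ≤ (1 + ⌊n/α⌋λ)^k (1 + ⌈n/α⌉λ)^{α−k}` where `⌊n/α⌋ = m`, `⌈n/α⌉ = m+1`. -/
theorem indepPoly_upper_bound {V : Type*} [Fintype V] (G : SimpleGraph V)
    (n α m s k : ℕ) (hn : Fintype.card V = n)
    (hα : (indepFinsets G).sup Finset.card = α)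
    (hdiv : n = m * α + s) (hs : s < α) (hk : k = α - s)
    (lam : ℝ) (hlam : 0 < lam) :
    indepPoly G lam ≤
      (1 + (m : ℝ) * lam) ^ k * (1 + ((m : ℝ) + 1) * lam) ^ (α - k) := by
  have h := sum_indepSubsets_le_balancedPoly G hlam.le univ α fun I hI => by
    rw [indepSubsets_univ] at hI
    exact hα ▸ le_sup (f := card) hI
  rw [indepSubsets_univ, card_univ, hn, hdiv, balancedPoly_mul_add lam hs.le] at h
  rwa [hk, Nat.sub_sub_self hs.le]
end

section
/- Let G be a graph on n vertices (n > 2) with independence number α, and let 0 < λ < 2/(n−2). Then the independence polynomial satisfies P_G(λ) ≥ (1+λ)^α + (n−α)λ, which is the independence polynomial of the graph K_{n−α} ∨ αK_1. -/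
open Finset

theorem exists_mem_indepFinsets_card_eq_sup {V : Type*} [Fintype V] (G : SimpleGraph V) :
    ∃ A ∈ indepFinsets G, A.card = (indepFinsets G).sup Finset.card := by
  have hne : (indepFinsets G).Nonempty := ⟨∅, by simp [indepFinsets]⟩
  obtain ⟨A, hA, h⟩ := Finset.exists_mem_eq_sup _ hne Finset.card
  exact ⟨A, hA, h.symm⟩

theorem mem_indepFinsets_of_subset {V : Type*} [Fintype V] {G : SimpleGraph V} {A B : Finset V}
    (hA : A ∈ indepFinsets G) (hBA : B ⊆ A) : B ∈ indepFinsets G := by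
  simp only [indepFinsets, mem_filter, mem_univ, true_and] at hA ⊢
  exact fun u hu v hv => hA u (hBA hu) v (hBA hv)

theorem singleton_mem_indepFinsets {V : Type*} [Fintype V] (G : SimpleGraph V) (v : V) :
    {v} ∈ indepFinsets G := by
  simp [indepFinsets]

/-- The subsets of an independent set `A` together with the singletons outside `A` bound the
independence polynomial from below at every nonnegative argument. -/
theorem indepPoly_ge_of_mem_indepFinsets {V : Type*} [Fintype V] {G : SimpleGraph V}
    {A : Finset V} (hA : A ∈ indepFinsets G) {x : ℝ} (hx : 0 ≤ x) :
    (1 + x) ^ A.card + ((Fintype.card V : ℝ) - A.card) * x ≤ indepPoly G x := by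
  classical
  have hdisj : Disjoint A.powerset (Aᶜ.image (singleton : V → Finset V)) := by
    rw [Finset.disjoint_left]
    intro B hB hB'
    obtain ⟨v, hv, rfl⟩ := mem_image.1 hB'
    exact mem_compl.1 hv (singleton_subset_iff.1 (mem_powerset.1 hB))
  have hsub : A.powerset ∪ Aᶜ.image singleton ⊆ indepFinsets G := by
    intro B hB
    rcases mem_union.1 hB with hB | hB
    · exact mem_indepFinsets_of_subset hA (mem_powerset.1 hB)
    · obtain ⟨v, -, rfl⟩ := mem_image.1 hB
      exact singleton_mem_indepFinsets G v
  have hpow : ∑ B ∈ A.powerset, x ^ B.card = (1 + x) ^ A.card := by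
    simpa [add_comm] using Finset.sum_pow_mul_eq_add_pow x 1 A
  have hsing : ∑ B ∈ Aᶜ.image (singleton : V → Finset V), x ^ B.card =
      ((Fintype.card V : ℝ) - A.card) * x := by
    rw [Finset.sum_image (Finset.singleton_injective.injOn)]
    simp [Finset.card_compl, Nat.cast_sub (Finset.card_le_univ A)]
  rw [← hpow, ← hsing, ← Finset.sum_union hdisj]
  exact Finset.sum_le_sum_of_subset_of_nonneg hsub fun B _ _ => pow_nonneg hx _

/-- Lower bound on the independence polynomial: if `G` has `n > 2` vertices and independence
number `α`, then for `0 < λ < 2/(n−2)`,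
`P_G(λ) ≥ (1+λ)^α + (n−α)λ`, the independence polynomial of `K_{n−α} ∨ αK_1`. -/
theorem indepPoly_lower_bound {V : Type*} [Fintype V] (G : SimpleGraph V)
    (n α : ℕ) (hn : Fintype.card V = n) (hn2 : 2 < n)
    (hα : (indepFinsets G).sup Finset.card = α)
    (lam : ℝ) (hlam : 0 < lam) (hlam2 : lam < 2 / ((n : ℝ) - 2)) :
    indepPoly G lam ≥ (1 + lam) ^ α + ((n : ℝ) - (α : ℝ)) * lam := by
  obtain ⟨A, hA, hcard⟩ := exists_mem_indepFinsets_card_eq_sup G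
  rw [← hn, ← hα, ← hcard]
  exact indepPoly_ge_of_mem_indepFinsets hA hlam.le
end

section
/- Let H be a graph on n vertices with clique number ω, and let λ > 0. Then the logarithmic derivative of the clique polynomial satisfies λ·Q'_H(λ)/Q_H(λ) ≤ λ·Q'_{T_ω(n)}(λ)/Q_{T_ω(n)}(λ), where T_ω(n) is the Turán graph on n vertices with clique number ω (the complete ω-partite graph with parts of sizes as nearly equal as possible). Equivalently, writing n_1,…,n_ω for the part sizes of T_ω(n), one has (Σ_{K clique of H} |K|·λ^{|K|}) / (Σ_{K clique of H} λ^{|K|}) ≤ Σ_{i=1}^{ω} n_i λ/(1+n_i λ). -/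
open Finset

/- The finset of all cliques (as finsets of vertices) of a graph `H`. -/
open Classical in
noncomputable def cliqueFinsets {V : Type*} [Fintype V] (H : SimpleGraph V) :
    Finset (Finset V) :=
  Finset.univ.filter fun s => ∀ u ∈ s, ∀ v ∈ s, u ≠ v → H.Adj u v

lemma mem_cliqueFinsets {V : Type*} [Fintype V] {H : SimpleGraph V} {s : Finset V} :
    s ∈ cliqueFinsets H ↔ ∀ u ∈ s, ∀ v ∈ s, u ≠ v → H.Adj u v := by
  simp [cliqueFinsets]

/-- The product of `x` over a set missing one of `u`, `v` is affine along the direction that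
transfers mass between `u` and `v`. -/
lemma add_mul_prod_eq_of_not_both_mem {V : Type*} [DecidableEq V] (x : V → ℕ) {u v : V}
    (huv : u ≠ v) {K : Finset V} (hK : ¬ (u ∈ K ∧ v ∈ K)) :
    ((x u : ℝ) + x v) * ∏ w ∈ K, (x w : ℝ) =
      x u * ∏ w ∈ K, ((Function.update (Function.update x u (x u + x v)) v 0 w : ℕ) : ℝ) +
      x v * ∏ w ∈ K, ((Function.update (Function.update x v (x u + x v)) u 0 w : ℕ) : ℝ) := by
  have off : ∀ (L : Finset V) (a b : V) (s t : ℕ), a ∉ L → b ∉ L →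
      ∏ w ∈ L, ((Function.update (Function.update x a s) b t w : ℕ) : ℝ) =
        ∏ w ∈ L, (x w : ℝ) := by
    intro L a b s t ha hb
    refine prod_congr rfl fun w hw => ?_
    rw [Function.update_of_ne (ne_of_mem_of_not_mem hw hb),
      Function.update_of_ne (ne_of_mem_of_not_mem hw ha)]
  by_cases hu : u ∈ K
  · have hv : v ∉ K.erase u := fun h => hK ⟨hu, mem_of_mem_erase h⟩
    have hu' : u ∉ K.erase u := notMem_erase u K
    rw [← insert_erase hu]
    simp only [prod_insert hu', off _ _ _ _ _ hu' hv, off _ _ _ _ _ hv hu']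
    simp [huv]
    ring
  · by_cases hv : v ∈ K
    · have hu' : u ∉ K.erase v := fun h => hu (mem_of_mem_erase h)
      have hv' : v ∉ K.erase v := notMem_erase v K
      rw [← insert_erase hv]
      simp only [prod_insert hv', off _ _ _ _ _ hu' hv', off _ _ _ _ _ hv' hu']
      simp [huv.symm]
      ring
    · rw [off _ _ _ _ _ hu hv, off _ _ _ _ _ hv hu]
      ring

/-- Zykov symmetrization: a weighted clique sum over a blow-up does not decrease when the
multiplicities are suitably concentrated, with unchanged total, on a clique. -/
lemma exists_clique_support_le {V : Type*} [Fintype V] (H : SimpleGraph V)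
    (a : Finset V → ℝ) (x : V → ℕ) :
    ∃ z : V → ℕ, ∑ v, z v = ∑ v, x v ∧ (univ.filter fun v => z v ≠ 0) ∈ cliqueFinsets H ∧
      ∑ K ∈ cliqueFinsets H, a K * ∏ v ∈ K, (x v : ℝ) ≤
        ∑ K ∈ cliqueFinsets H, a K * ∏ v ∈ K, (z v : ℝ) := by
  classical
  induction hm : (univ.filter fun v => x v ≠ 0).card using Nat.strong_induction_on
    generalizing x with
  | _ m ih =>
    by_cases hc : (univ.filter fun v => x v ≠ 0) ∈ cliqueFinsets H
    · exact ⟨x, rfl, hc, le_rfl⟩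
    rw [mem_cliqueFinsets] at hc
    push Not at hc
    obtain ⟨u, hu, v, hv, huv, hadj⟩ := hc
    have hu0 : x u ≠ 0 := by simpa using hu
    have hv0 : x v ≠ 0 := by simpa using hv
    have total : ∀ b c : V, b ≠ c → ∀ s, s = x b + x c →
        ∑ w, Function.update (Function.update x b s) c 0 w = ∑ w, x w := by
      intro b c hbc s hs
      have hb : b ∈ univ \ {c} := by simp [hbc]
      rw [sum_update_of_mem (mem_univ c), sum_update_of_mem hb, zero_add, hs,
        ← sum_sdiff (subset_univ {c}), sum_singleton, ← sum_sdiff (singleton_subset_iff.2 hb),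
        sum_singleton]
      ring
    have small : ∀ b c : V, x b ≠ 0 → x c ≠ 0 → ∀ s,
        (univ.filter fun w => Function.update (Function.update x b s) c 0 w ≠ 0).card < m := by
      intro b c hb0 hc0 s
      rw [← hm]
      refine card_lt_card ((ssubset_iff_of_subset fun w hw => ?_).2 ⟨c, by simpa, by simp⟩)
      simp only [mem_filter, mem_univ, true_and, Function.update_apply] at hw ⊢
      split_ifs at hw with h1 h2
      · exact absurd rfl hw
      · rwa [h2]
      · exact hw
    obtain ⟨z₁, hz₁, hs₁, hle₁⟩ := ih _ (small u v hu0 hv0 (x u + x v)) _ rfl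
    obtain ⟨z₂, hz₂, hs₂, hle₂⟩ := ih _ (small v u hv0 hu0 (x u + x v)) _ rfl
    rw [total u v huv _ rfl] at hz₁
    rw [total v u huv.symm _ (add_comm _ _)] at hz₂
    have key : ((x u : ℝ) + x v) * ∑ K ∈ cliqueFinsets H, a K * ∏ w ∈ K, (x w : ℝ) =
        x u * ∑ K ∈ cliqueFinsets H, a K *
          ∏ w ∈ K, ((Function.update (Function.update x u (x u + x v)) v 0 w : ℕ) : ℝ) +
        x v * ∑ K ∈ cliqueFinsets H, a K *
          ∏ w ∈ K, ((Function.update (Function.update x v (x u + x v)) u 0 w : ℕ) : ℝ) := by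
      rw [mul_sum, mul_sum, mul_sum, ← sum_add_distrib]
      refine sum_congr rfl fun K hK => ?_
      have hnot : ¬ (u ∈ K ∧ v ∈ K) := fun h =>
        hadj (mem_cliqueFinsets.1 hK u h.1 v h.2 huv)
      linear_combination a K * add_mul_prod_eq_of_not_both_mem x huv hnot
    have hupos : (0 : ℝ) < x u := by positivity
    have hvpos : (0 : ℝ) < x v := by positivity
    rcases le_total (∑ K ∈ cliqueFinsets H, a K * ∏ w ∈ K, (z₁ w : ℝ))
      (∑ K ∈ cliqueFinsets H, a K * ∏ w ∈ K, (z₂ w : ℝ)) with h | h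
    · exact ⟨z₂, hz₂, hs₂, by nlinarith⟩
    · exact ⟨z₁, hz₁, hs₁, by nlinarith⟩

lemma sum_powerset_card_mul_prod {V : Type*} (S : Finset V) (y : V → ℝ)
    (hy : ∀ v, 0 ≤ y v) :
    ∑ K ∈ S.powerset, (K.card : ℝ) * ∏ v ∈ K, y v =
      (∑ v ∈ S, y v / (1 + y v)) * ∏ v ∈ S, (1 + y v) := by
  classical
  induction S using Finset.induction_on with
  | empty => simp
  | insert v S hv ih =>
    have hins : ∑ K ∈ S.powerset, ((insert v K).card : ℝ) * ∏ w ∈ insert v K, y w =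
        y v * ∑ K ∈ S.powerset, (K.card : ℝ) * ∏ w ∈ K, y w +
          y v * ∏ w ∈ S, (1 + y w) := by
      rw [prod_one_add, mul_sum, mul_sum, ← sum_add_distrib]
      refine sum_congr rfl fun K hK => ?_
      have hvK : v ∉ K := fun h => hv (mem_powerset.1 hK h)
      rw [card_insert_of_notMem hvK, prod_insert hvK]
      push_cast
      ring
    have hpos : 1 + y v ≠ 0 := by linarith [hy v]
    rw [sum_powerset_insert hv, hins, ih, sum_insert hv, prod_insert hv]
    field_simp
    ring

/-- An integer concavity estimate: the secant of `t ↦ t * c / (1 + t * c)` through `q` and `q + 1`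
lies above the function at every natural number. -/
lemma mul_div_one_add_mul_le_secant {c : ℝ} (hc : 0 < c) (q m : ℕ) :
    (m : ℝ) * c / (1 + m * c) ≤ q * c / (1 + q * c) +
      ((m : ℝ) - q) * (((q : ℝ) + 1) * c / (1 + ((q : ℝ) + 1) * c) - q * c / (1 + q * c)) := by
  have hint : 0 ≤ ((m : ℝ) - q) * (m - q - 1) := by
    rcases Nat.lt_or_ge q m with h | h
    · have : (q : ℝ) + 1 ≤ m := by exact_mod_cast h
      exact mul_nonneg (by linarith) (by linarith)
    · have : (m : ℝ) ≤ q := by exact_mod_cast h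
      exact mul_nonneg_of_nonpos_of_nonpos (by linarith) (by linarith)
  rw [← sub_nonneg]
  have hdiff : (q : ℝ) * c / (1 + q * c) + ((m : ℝ) - q) *
      (((q : ℝ) + 1) * c / (1 + ((q : ℝ) + 1) * c) - q * c / (1 + q * c)) -
        (m : ℝ) * c / (1 + m * c) =
      ((m : ℝ) - q) * (m - q - 1) * c ^ 2 /
        ((1 + m * c) * (1 + q * c) * (1 + ((q : ℝ) + 1) * c)) := by
    have h1 : 1 + (m : ℝ) * c ≠ 0 := by positivity
    have h2 : 1 + (q : ℝ) * c ≠ 0 := by positivity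
    have h3 : 1 + ((q : ℝ) + 1) * c ≠ 0 := by positivity
    field_simp
    ring
  rw [hdiff]
  positivity

/-- Among at most `ω` natural numbers with sum `q * ω + r`, the sum of `t * c / (1 + t * c)` is
largest for the balanced distribution. -/
lemma sum_mul_div_one_add_mul_le_balanced {V : Type*} {c : ℝ} (hc : 0 < c) (S : Finset V)
    (z : V → ℕ) {ω q r : ℕ} (hS : S.card ≤ ω) (hr : r ≤ ω)
    (hz : ∑ v ∈ S, z v = q * ω + r) :
    ∑ v ∈ S, (z v : ℝ) * c / (1 + z v * c) ≤
      ((ω - r : ℕ) : ℝ) * ((q : ℝ) * c / (1 + (q : ℝ) * c)) +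
        (r : ℝ) * (((q : ℝ) + 1) * c / (1 + ((q : ℝ) + 1) * c)) := by
  have hsum := sum_le_sum fun v (_ : v ∈ S) => mul_div_one_add_mul_le_secant hc q (z v)
  have hzero := mul_div_one_add_mul_le_secant hc q 0
  rw [sum_add_distrib, ← sum_mul, sum_sub_distrib] at hsum
  have hz' : ∑ v ∈ S, (z v : ℝ) = q * ω + r := by exact_mod_cast hz
  have hS' : (S.card : ℝ) ≤ ω := by exact_mod_cast hS
  rw [hz'] at hsum
  simp only [sum_const, nsmul_eq_mul] at hsum
  rw [Nat.cast_sub hr]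
  simp only [Nat.cast_zero, zero_mul, zero_div] at hzero
  generalize (q : ℝ) * c / (1 + (q : ℝ) * c) = A at *
  generalize ((q : ℝ) + 1) * c / (1 + ((q : ℝ) + 1) * c) = B at *
  nlinarith [mul_nonneg (sub_nonneg.2 hS') hzero]

/-- Lemma 2.4: if `H` has `n` vertices and clique number `ω`, writing `n = q·ω + r` with
`0 ≤ r < ω` (so the Turán graph `T_ω(n)` has `ω − r` parts of size `q` and `r` parts of size
`q+1`), then for `λ > 0` the logarithmic derivative of the clique polynomial satisfies
`λQ'_H(λ)/Q_H(λ) = (Σ_K |K|λ^{|K|})/(Σ_K λ^{|K|}) ≤ Σ_{i=1}^{ω} n_iλ/(1+n_iλ)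
  = (ω−r)·qλ/(1+qλ) + r·(q+1)λ/(1+(q+1)λ)`. -/
theorem clique_log_deriv_le_turan {V : Type*} [Fintype V] (H : SimpleGraph V)
    (n ω q r : ℕ) (hn : Fintype.card V = n)
    (hω : (cliqueFinsets H).sup Finset.card = ω)
    (hdiv : n = q * ω + r) (hr : r < ω)
    (lam : ℝ) (hlam : 0 < lam) :
    (∑ K ∈ cliqueFinsets H, (K.card : ℝ) * lam ^ K.card) /
        (∑ K ∈ cliqueFinsets H, lam ^ K.card) ≤
      ((ω - r : ℕ) : ℝ) * ((q : ℝ) * lam / (1 + (q : ℝ) * lam)) +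
        (r : ℝ) * (((q : ℝ) + 1) * lam / (1 + ((q : ℝ) + 1) * lam)) := by
  classical
  set c : ℝ := ((ω - r : ℕ) : ℝ) * ((q : ℝ) * lam / (1 + (q : ℝ) * lam)) +
    (r : ℝ) * (((q : ℝ) + 1) * lam / (1 + ((q : ℝ) + 1) * lam)) with hcdef
  have hQ : 0 < ∑ K ∈ cliqueFinsets H, lam ^ K.card :=
    sum_pos (fun K _ => by positivity) ⟨∅, by simp [mem_cliqueFinsets]⟩
  rw [div_le_iff₀ hQ, mul_sum, ← sub_nonpos, ← sum_sub_distrib]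
  obtain ⟨z, hz, hS, hle⟩ := exists_clique_support_le H
    (fun K => ((K.card : ℝ) - c) * lam ^ K.card) (fun _ => 1)
  set S := univ.filter fun v => z v ≠ 0 with hSdef
  have hSz : ∑ v ∈ S, z v = q * ω + r := by
    rw [hSdef, sum_filter_ne_zero, hz, ← hdiv, ← hn]
    simp
  have hScard : S.card ≤ ω := hω ▸ le_sup (f := Finset.card) hS
  have hbal := sum_mul_div_one_add_mul_le_balanced hlam S z hScard hr.le hSz
  have hsub : S.powerset ⊆ cliqueFinsets H := fun K hK => mem_cliqueFinsets.2
    fun u hu v hv => mem_cliqueFinsets.1 hS u (mem_powerset.1 hK hu) v (mem_powerset.1 hK hv)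
  have hout : ∀ K ∈ cliqueFinsets H, K ∉ S.powerset →
      ((K.card : ℝ) - c) * lam ^ K.card * ∏ v ∈ K, (z v : ℝ) = 0 := by
    intro K _ hK
    rw [mem_powerset, not_subset] at hK
    obtain ⟨v, hvK, hvS⟩ := hK
    have : z v = 0 := by simpa [hSdef] using hvS
    rw [prod_eq_zero hvK (by simp [this]), mul_zero]
  have hval : ∑ K ∈ S.powerset, ((K.card : ℝ) - c) * lam ^ K.card * ∏ v ∈ K, (z v : ℝ) =
      (∑ v ∈ S, (z v : ℝ) * lam / (1 + z v * lam) - c) * ∏ v ∈ S, (1 + (z v : ℝ) * lam) := by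
    rw [sub_mul, ← sum_powerset_card_mul_prod S (fun v => (z v : ℝ) * lam)
      (fun v => by positivity), prod_one_add, mul_sum, ← sum_sub_distrib]
    refine sum_congr rfl fun K _ => ?_
    rw [prod_mul_distrib, prod_const]
    ring
  calc ∑ K ∈ cliqueFinsets H, ((K.card : ℝ) * lam ^ K.card - c * lam ^ K.card)
      ≤ ∑ K ∈ cliqueFinsets H, ((K.card : ℝ) - c) * lam ^ K.card * ∏ v ∈ K, (z v : ℝ) := by
        simpa [sub_mul] using hle
    _ = (∑ v ∈ S, (z v : ℝ) * lam / (1 + z v * lam) - c) *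
          ∏ v ∈ S, (1 + (z v : ℝ) * lam) := by
        rw [← sum_subset hsub hout, hval]
    _ ≤ 0 := mul_nonpos_of_nonpos_of_nonneg (sub_nonpos.2 hbal)
        (prod_nonneg fun v _ => by positivity)
end

section
/- Let n be a positive integer and 0 < p < 1, and let Y be a binomial random variable with parameters n and p. For each t = 1, 2, …, n, the conditional variance satisfies Var(Y | Y ≤ t) ≥ Var(Y | Y ≤ t−1). Explicitly, writing b_r = C(n,r)p^r(1−p)^{n−r} and F_t = Σ_{k=0}^{t} b_k, for each t = 1,…,n one has (Σ_{k=0}^{t} k² b_k)/F_t − ((Σ_{k=0}^{t} k b_k)/F_t)² ≥ (Σ_{k=0}^{t−1} k² b_k)/F_{t−1} − ((Σ_{k=0}^{t−1} k b_k)/F_{t−1})². -/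
open Finset

/- The binomial probability mass function `b_r = C(n,r) p^r (1−p)^{n−r}`. -/
noncomputable def binomPMF (n : ℕ) (p : ℝ) (r : ℕ) : ℝ :=
  (n.choose r : ℝ) * p ^ r * (1 - p) ^ (n - r)

theorem binomPMF_pos {n : ℕ} {p : ℝ} (hp0 : 0 < p) (hp1 : p < 1) {k : ℕ} (hk : k ≤ n) :
    0 < binomPMF n p k := by
  have h1 : (0 : ℝ) < n.choose k := by exact_mod_cast Nat.choose_pos hk
  have h2 : 0 < 1 - p := by linarith
  unfold binomPMF
  positivity

theorem choose_mul_choose_le_sq (n k : ℕ) (hk : k + 2 ≤ n) :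
    (n.choose (k + 2) : ℝ) * n.choose k ≤ (n.choose (k + 1) : ℝ) ^ 2 := by
  obtain ⟨m, rfl⟩ := Nat.exists_eq_add_of_le hk
  have h1 := Nat.choose_succ_right_eq (k + 2 + m) k
  have h2 := Nat.choose_succ_right_eq (k + 2 + m) (k + 1)
  rw [show k + 2 + m - k = m + 2 by lia] at h1
  rw [show k + 2 + m - (k + 1) = m + 1 by lia] at h2
  norm_cast
  generalize (k + 2 + m).choose k = a at *
  generalize (k + 2 + m).choose (k + 1) = b at *
  generalize (k + 2 + m).choose (k + 1 + 1) = c at *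
  refine Nat.le_of_mul_le_mul_right (c := (k + 2) * (m + 2)) ?_ (by positivity)
  calc c * a * ((k + 2) * (m + 2)) = (c * (k + 1 + 1)) * (a * (m + 2)) := by ring
    _ = b ^ 2 * ((m + 1) * (k + 1)) := by rw [h2, ← h1]; ring
    _ ≤ b ^ 2 * ((k + 2) * (m + 2)) := Nat.mul_le_mul_left _ (by nlinarith)

theorem binomPMF_logConcave {n : ℕ} {p : ℝ} (hp0 : 0 < p) (hp1 : p < 1) (k : ℕ)
    (hk : k + 2 ≤ n) :
    binomPMF n p (k + 2) * binomPMF n p k ≤ binomPMF n p (k + 1) ^ 2 := by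
  have hc := choose_mul_choose_le_sq n k hk
  have hq : 0 < 1 - p := by linarith
  obtain ⟨m, rfl⟩ := Nat.exists_eq_add_of_le hk
  unfold binomPMF
  rw [show k + 2 + m - k = m + 2 by lia, show k + 2 + m - (k + 1) = m + 1 by lia,
    show k + 2 + m - (k + 2) = m by lia]
  have hw : 0 ≤ p ^ (2 * k + 2) * (1 - p) ^ (2 * m + 2) := by positivity
  have := mul_le_mul_of_nonneg_right hc hw
  calc _ = _ := by ring
    _ ≤ _ := this
    _ = _ := by ring

section LogConcave

variable {b : ℕ → ℝ} {n : ℕ}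

/-- For a log-concave sequence, the ratio of a term to the sum of the preceding ones decreases. -/
theorem logConcave_mul_sum_le (hb : ∀ k ≤ n, 0 < b k)
    (hlc : ∀ k, k + 2 ≤ n → b (k + 2) * b k ≤ b (k + 1) ^ 2) (t : ℕ) (ht : t + 1 ≤ n) :
    b (t + 1) * ∑ k ∈ range t, b k ≤ b t * ∑ k ∈ range (t + 1), b k := by
  induction t with
  | zero => simpa using mul_self_nonneg (b 0)
  | succ t ih =>
    have ih := ih (by lia)
    have h0 := hb t (by lia)
    have h1 := hb (t + 1) (by lia)
    have hl := hlc t ht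
    have hF : 0 ≤ ∑ k ∈ range (t + 1), b k :=
      sum_nonneg fun k hk => (hb k (by have := mem_range.1 hk; lia)).le
    rw [sum_range_succ _ (t + 1)]
    have hs := sum_range_succ b t
    generalize ∑ k ∈ range (t + 1), b k = F' at *
    refine le_of_mul_le_mul_left ?_ h0
    calc b t * (b (t + 1 + 1) * F') = (b (t + 2) * b t) * F' := by ring
      _ ≤ b (t + 1) ^ 2 * F' := by gcongr
      _ = b (t + 1) * (b (t + 1) * ∑ k ∈ range t, b k + b (t + 1) * b t) := by rw [hs]; ring
      _ ≤ b (t + 1) * (b t * F' + b (t + 1) * b t) := by gcongr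
      _ = b t * (b (t + 1) * (F' + b (t + 1))) := by ring

theorem sum_range_succ_sub_mul (b : ℕ → ℝ) (t : ℕ) :
    ∑ k ∈ range (t + 1), (((t + 1 : ℕ) : ℝ) - k) * b k =
      ∑ k ∈ range t, ((t : ℝ) - k) * b k + ∑ k ∈ range (t + 1), b k := by
  have : ∑ k ∈ range t, ((t : ℝ) - k) * b k = ∑ k ∈ range (t + 1), ((t : ℝ) - k) * b k := by
    simp [sum_range_succ]
  rw [this, ← sum_add_distrib]
  exact sum_congr rfl fun k _ => by push_cast; ring

theorem sum_range_succ_sub_sq_mul (b : ℕ → ℝ) (t : ℕ) :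
    ∑ k ∈ range (t + 1), (((t + 1 : ℕ) : ℝ) - k) ^ 2 * b k =
      ∑ k ∈ range t, ((t : ℝ) - k) ^ 2 * b k + 2 * ∑ k ∈ range t, ((t : ℝ) - k) * b k +
        ∑ k ∈ range (t + 1), b k := by
  have h1 : ∑ k ∈ range t, ((t : ℝ) - k) * b k = ∑ k ∈ range (t + 1), ((t : ℝ) - k) * b k := by
    simp [sum_range_succ]
  have h2 : ∑ k ∈ range t, ((t : ℝ) - k) ^ 2 * b k =
      ∑ k ∈ range (t + 1), ((t : ℝ) - k) ^ 2 * b k := by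
    simp [sum_range_succ]
  rw [h1, h2, mul_sum, ← sum_add_distrib, ← sum_add_distrib]
  exact sum_congr rfl fun k _ => by push_cast; ring

theorem sum_sub_mul_nonneg (hb : ∀ k ≤ n, 0 < b k) (t : ℕ) (ht : t ≤ n) :
    0 ≤ ∑ k ∈ range t, ((t : ℝ) - k) * b k := by
  refine sum_nonneg fun k hk => ?_
  have hkt := mem_range.1 hk
  have : (k : ℝ) ≤ t := by exact_mod_cast hkt.le
  exact mul_nonneg (by linarith) (hb k (by lia)).le

/-- The product of the mean distance to `t` and the ratio `b t / ∑ k < t, b k` is at most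
`1 + b t / ∑ k < t, b k`, with denominators cleared. -/
theorem logConcave_sum_sub_mul_le (hb : ∀ k ≤ n, 0 < b k)
    (hlc : ∀ k, k + 2 ≤ n → b (k + 2) * b k ≤ b (k + 1) ^ 2) (t : ℕ) (ht : t ≤ n) :
    (∑ k ∈ range t, ((t : ℝ) - k) * b k) * b t ≤
      (∑ k ∈ range t, b k) * ∑ k ∈ range (t + 1), b k := by
  induction t with
  | zero => simp
  | succ t ih =>
    have ih := ih (by lia)
    have hm := logConcave_mul_sum_le hb hlc t ht
    have h0 := hb t (by lia)
    have h1 := hb (t + 1) ht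
    have hF : 0 ≤ ∑ k ∈ range (t + 1), b k :=
      sum_nonneg fun k hk => (hb k (by have := mem_range.1 hk; lia)).le
    rw [sum_range_succ_sub_mul, sum_range_succ _ (t + 1)]
    generalize ∑ k ∈ range (t + 1), b k = F' at *
    generalize ∑ k ∈ range t, b k = F at *
    generalize ∑ k ∈ range t, ((t : ℝ) - k) * b k = A at *
    have key : A * b (t + 1) ≤ F' ^ 2 := by
      refine le_of_mul_le_mul_left ?_ h0
      calc b t * (A * b (t + 1)) = (A * b t) * b (t + 1) := by ring
        _ ≤ (F * F') * b (t + 1) := by gcongr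
        _ = (b (t + 1) * F) * F' := by ring
        _ ≤ (b t * F') * F' := by gcongr
        _ = b t * F' ^ 2 := by ring
    linarith

/-- The comparison of second and first moments of the distance to `t` that expresses monotonicity
of the truncated variance, with denominators cleared. -/
theorem logConcave_sum_sub_sq_mul_le (hb : ∀ k ≤ n, 0 < b k)
    (hlc : ∀ k, k + 2 ≤ n → b (k + 2) * b k ≤ b (k + 1) ^ 2) (t : ℕ) (ht : t ≤ n) :
    (∑ k ∈ range t, ((t : ℝ) - k) ^ 2 * b k) * (∑ k ∈ range t, b k) *
        (∑ k ∈ range (t + 1), b k) ≤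
      (∑ k ∈ range t, ((t : ℝ) - k) * b k) ^ 2 *
        (∑ k ∈ range t, b k + ∑ k ∈ range (t + 1), b k) := by
  induction t with
  | zero => simp
  | succ t ih =>
    have ih := ih (by lia)
    have ht' : t ≤ n := by lia
    have hA := sum_sub_mul_nonneg hb t ht'
    have h2 := logConcave_sum_sub_mul_le hb hlc t ht'
    have h3 := logConcave_sum_sub_mul_le hb hlc (t + 1) ht
    have h0 := hb t (by lia)
    have h1 := hb (t + 1) ht
    have hF' : 0 < ∑ k ∈ range (t + 1), b k :=
      sum_pos (fun k hk => hb k (by have := mem_range.1 hk; lia)) ⟨0, by simp⟩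
    have hs := sum_range_succ b t
    rw [sum_range_succ_sub_mul, sum_range_succ _ (t + 1)] at h3
    rw [sum_range_succ_sub_mul, sum_range_succ_sub_sq_mul, sum_range_succ _ (t + 1)]
    rcases Nat.eq_zero_or_pos t with rfl | htpos
    · simp only [range_zero, sum_empty] at *
      nlinarith [pow_pos hF' 3]
    have hF : 0 < ∑ k ∈ range t, b k :=
      sum_pos (fun k hk => hb k (by have := mem_range.1 hk; lia)) ⟨0, by simpa using htpos⟩
    generalize ∑ k ∈ range (t + 1), b k = F' at *
    generalize ∑ k ∈ range t, b k = F at *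
    generalize ∑ k ∈ range t, ((t : ℝ) - k) ^ 2 * b k = Q at *
    generalize ∑ k ∈ range t, ((t : ℝ) - k) * b k = A at *
    generalize b (t + 1) = c at *
    generalize b t = a at *
    have hc : A * c ≤ F' ^ 2 := by linarith
    have hV : F * (Q * F' - A ^ 2) ≤ A ^ 2 * F' := by linarith
    have hD : (F' + c) * A ^ 2 ≤ (A + F') ^ 2 * F := by
      have e1 := mul_le_mul_of_nonneg_left h2 hA
      have e2 := mul_le_mul_of_nonneg_left hc hA
      have e3 := mul_le_mul_of_nonneg_left h2 hF'.le
      subst hs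
      linarith
    have hfin : (F' + c) * (Q * F' - A ^ 2) ≤ (A + F') ^ 2 * F' := by
      refine le_of_mul_le_mul_left ?_ hF
      calc F * ((F' + c) * (Q * F' - A ^ 2)) = (F' + c) * (F * (Q * F' - A ^ 2)) := by ring
        _ ≤ (F' + c) * (A ^ 2 * F') := by gcongr
        _ = ((F' + c) * A ^ 2) * F' := by ring
        _ ≤ ((A + F') ^ 2 * F) * F' := by gcongr
        _ = F * ((A + F') ^ 2 * F') := by ring
    linarith

end LogConcave

/-- Lemma 3.3: let `Y ~ Bin(n, p)` with `0 < p < 1`.  For every `t = 1, …, n`, the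
conditional variance of `Y` given `Y ≤ t` is at least that given `Y ≤ t−1`:
`(Σ_{k≤t} k²b_k)/F_t − ((Σ_{k≤t} k b_k)/F_t)² ≥ (Σ_{k≤t−1} k²b_k)/F_{t−1} − ((Σ_{k≤t−1} k b_k)/F_{t−1})²`. -/
theorem binomial_conditional_variance_mono (n : ℕ) (hn : 0 < n)
    (p : ℝ) (hp0 : 0 < p) (hp1 : p < 1) (t : ℕ) (ht1 : 1 ≤ t) (htn : t ≤ n) :
    (∑ k ∈ Finset.range (t + 1), (k : ℝ) ^ 2 * binomPMF n p k) /
          (∑ k ∈ Finset.range (t + 1), binomPMF n p k) -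
        ((∑ k ∈ Finset.range (t + 1), (k : ℝ) * binomPMF n p k) /
          (∑ k ∈ Finset.range (t + 1), binomPMF n p k)) ^ 2 ≥
      (∑ k ∈ Finset.range t, (k : ℝ) ^ 2 * binomPMF n p k) /
          (∑ k ∈ Finset.range t, binomPMF n p k) -
        ((∑ k ∈ Finset.range t, (k : ℝ) * binomPMF n p k) /
          (∑ k ∈ Finset.range t, binomPMF n p k)) ^ 2 := by
  have hb : ∀ k ≤ n, 0 < binomPMF n p k := fun k hk => binomPMF_pos hp0 hp1 hk
  have key := logConcave_sum_sub_sq_mul_le hb (binomPMF_logConcave hp0 hp1) t htn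
  have hF : 0 < ∑ k ∈ range t, binomPMF n p k :=
    sum_pos (fun k hk => hb k (by have := mem_range.1 hk; lia)) ⟨0, mem_range.2 ht1⟩
  have hA : ∑ k ∈ range t, ((t : ℝ) - k) * binomPMF n p k =
      t * ∑ k ∈ range t, binomPMF n p k - ∑ k ∈ range t, (k : ℝ) * binomPMF n p k := by
    rw [mul_sum, ← sum_sub_distrib]
    exact sum_congr rfl fun k _ => by ring
  have hQ : ∑ k ∈ range t, ((t : ℝ) - k) ^ 2 * binomPMF n p k =
      (t : ℝ) ^ 2 * ∑ k ∈ range t, binomPMF n p k -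
        2 * t * ∑ k ∈ range t, (k : ℝ) * binomPMF n p k +
        ∑ k ∈ range t, (k : ℝ) ^ 2 * binomPMF n p k := by
    rw [mul_sum, mul_sum, ← sum_sub_distrib, ← sum_add_distrib]
    exact sum_congr rfl fun k _ => by ring
  have ha := hb t htn
  rw [hA, hQ] at key
  simp only [sum_range_succ _ t] at key ⊢
  generalize ∑ k ∈ range t, binomPMF n p k = F at *
  generalize ∑ k ∈ range t, (k : ℝ) * binomPMF n p k = S at *
  generalize ∑ k ∈ range t, (k : ℝ) ^ 2 * binomPMF n p k = R at *
  generalize binomPMF n p t = a at *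
  have hF' : 0 < F + a := by linarith
  rw [ge_iff_le, ← sub_nonneg]
  have e : (R + (t : ℝ) ^ 2 * a) / (F + a) - ((S + t * a) / (F + a)) ^ 2 -
      (R / F - (S / F) ^ 2) =
      a * ((t * F - S) ^ 2 * (F + (F + a)) - ((t : ℝ) ^ 2 * F - 2 * t * S + R) * F * (F + a)) /
        ((F + a) ^ 2 * F ^ 2) := by
    field_simp
    ring
  rw [e]
  exact div_nonneg (mul_nonneg ha.le (by linarith)) (by positivity)
end
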